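/- arXiv:2510.09992 — 2 statements merged into one kernel-verified Lean document; each statement's English description precedes it below -/
import Mathlib

section
/- Let η : ℝ² → ℝ be smooth with η(x) > 0 for all x, and define q₀, w₁, w₂, w₃ as in the context. Then the vector field w = (w₁,w₂,w₃) is divergence free on ℝ² × ℝ: for all (x,z) ∈ ℝ² × ℝ, ∂₁w₁(x,z) + ∂₂w₂(x,z) + ∂₃w₃(x,z) = 0, where ∂₁, ∂₂ are the partial derivatives in the two horizontal variables x = (x₁,x₂) and ∂₃ is the partial derivative in the vertical variable z. -/
noncomputable section

/-- Partial derivative of `f : ℝ² → ℝ` in the first horizontal variable. -/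
def pdx1 (f : ℝ × ℝ → ℝ) (x : ℝ × ℝ) : ℝ := deriv (fun s => f (s, x.2)) x.1

/-- Partial derivative of `f : ℝ² → ℝ` in the second horizontal variable. -/
def pdx2 (f : ℝ × ℝ → ℝ) (x : ℝ × ℝ) : ℝ := deriv (fun s => f (x.1, s)) x.2

/-- Horizontal Laplacian of `f : ℝ² → ℝ`. -/
def lapx (f : ℝ × ℝ → ℝ) (x : ℝ × ℝ) : ℝ := pdx1 (pdx1 f) x + pdx2 (pdx2 f) x

/-- The pressure-like quantity `q₀ = −6/η²`. -/
def q0 (η : ℝ × ℝ → ℝ) (x : ℝ × ℝ) : ℝ := -6 / (η x) ^ 2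

/-- First component of the test function: `w₁(x,z) = ½ z (z − η(x)) ∂₁q₀(x)`. -/
def w1 (η : ℝ × ℝ → ℝ) (x : ℝ × ℝ) (z : ℝ) : ℝ :=
  (1 / 2) * z * (z - η x) * pdx1 (q0 η) x

/-- Second component of the test function: `w₂(x,z) = ½ z (z − η(x)) ∂₂q₀(x)`. -/
def w2 (η : ℝ × ℝ → ℝ) (x : ℝ × ℝ) (z : ℝ) : ℝ :=
  (1 / 2) * z * (z - η x) * pdx2 (q0 η) x

/-- Third component of the test function:
`w₃(x,z) = (1/12) z² (3η − 2z) Δ_x q₀ + ¼ z² ∇_xη·∇_x q₀`. -/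
def w3 (η : ℝ × ℝ → ℝ) (x : ℝ × ℝ) (z : ℝ) : ℝ :=
  (1 / 12) * z ^ 2 * (3 * η x - 2 * z) * lapx (q0 η) x
    + (1 / 4) * z ^ 2 * (pdx1 η x * pdx1 (q0 η) x + pdx2 η x * pdx2 (q0 η) x)

/-- Partial derivative in the first horizontal variable of a function of `(x,z) ∈ ℝ² × ℝ`. -/
def pd1 (f : ℝ × ℝ → ℝ → ℝ) (x : ℝ × ℝ) (z : ℝ) : ℝ := deriv (fun s => f (s, x.2) z) x.1

/-- Partial derivative in the second horizontal variable of a function of `(x,z) ∈ ℝ² × ℝ`. -/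
def pd2 (f : ℝ × ℝ → ℝ → ℝ) (x : ℝ × ℝ) (z : ℝ) : ℝ := deriv (fun s => f (x.1, s) z) x.2

/-- Partial derivative in the vertical variable `z` of a function of `(x,z) ∈ ℝ² × ℝ`. -/
def pd3 (f : ℝ × ℝ → ℝ → ℝ) (x : ℝ × ℝ) (z : ℝ) : ℝ := deriv (f x) z

end

/-- Product rule for the one-dimensional slices of the horizontal components. -/
theorem deriv_half_mul_sub_mul_deriv {h g : ℝ → ℝ} {t : ℝ} (z : ℝ)
    (hh : DifferentiableAt ℝ h t) (hg : ContDiff ℝ 2 g) :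
    deriv (fun s => (1 / 2) * z * (z - h s) * deriv g s) t
      = (1 / 2) * z * ((z - h t) * deriv (deriv g) t - deriv h t * deriv g t) := by
  have hg' : DifferentiableAt ℝ (deriv g) t := hg.differentiable_deriv_two t
  refine (((hh.hasDerivAt.const_sub z).const_mul ((1 / 2) * z)).mul hg'.hasDerivAt).deriv.trans ?_
  ring

/-- The vertical components are cubic polynomials in `z`. -/
theorem deriv_cubic_profile (a b c z : ℝ) :
    deriv (fun z : ℝ => (1 / 12) * z ^ 2 * (3 * a - 2 * z) * b + (1 / 4) * z ^ 2 * c) z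
      = (1 / 2) * z * (a - z) * b + (1 / 2) * z * c := by
  have hsq : HasDerivAt (fun z : ℝ => z ^ 2) (2 * z) z := by simpa using hasDerivAt_pow 2 z
  have hlin : HasDerivAt (fun z : ℝ => 3 * a - 2 * z) (-(2 * 1)) z :=
    ((hasDerivAt_id z).const_mul 2).const_sub (3 * a)
  refine ((((hsq.const_mul (1 / 12)).mul hlin).mul_const b).add
    ((hsq.const_mul (1 / 4)).mul_const c)).deriv.trans ?_
  ring

theorem contDiff_q0 {η : ℝ × ℝ → ℝ} {n : WithTop ℕ∞} (hη : ContDiff ℝ n η)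
    (hne : ∀ x, η x ≠ 0) : ContDiff ℝ n (q0 η) :=
  contDiff_const.div (hη.pow 2) fun x => pow_ne_zero 2 (hne x)

/-- The test function `w = (w₁,w₂,w₃)` is divergence free on `ℝ² × ℝ`. -/
theorem w_div_free (η : ℝ × ℝ → ℝ) (hη : ContDiff ℝ (⊤ : ℕ∞) η) (hpos : ∀ x, 0 < η x) :
    ∀ (x : ℝ × ℝ) (z : ℝ),
      pd1 (w1 η) x z + pd2 (w2 η) x z + pd3 (w3 η) x z = 0 := by
  intro x z
  have hη2 : ContDiff ℝ 2 η := contDiff_infty.mp hη 2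
  have hq : ContDiff ℝ 2 (q0 η) := contDiff_q0 hη2 fun x => (hpos x).ne'
  have hfst : ContDiff ℝ 2 fun s : ℝ => (s, x.2) := contDiff_id.prodMk contDiff_const
  have hsnd : ContDiff ℝ 2 fun s : ℝ => (x.1, s) := contDiff_const.prodMk contDiff_id
  have h1 : pd1 (w1 η) x z = (1 / 2) * z *
      ((z - η x) * pdx1 (pdx1 (q0 η)) x - pdx1 η x * pdx1 (q0 η) x) :=
    deriv_half_mul_sub_mul_deriv z ((hη2.comp hfst).differentiable two_ne_zero x.1) (hq.comp hfst)
  have h2 : pd2 (w2 η) x z = (1 / 2) * z *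
      ((z - η x) * pdx2 (pdx2 (q0 η)) x - pdx2 η x * pdx2 (q0 η) x) :=
    deriv_half_mul_sub_mul_deriv z ((hη2.comp hsnd).differentiable two_ne_zero x.2) (hq.comp hsnd)
  have h3 : pd3 (w3 η) x z = (1 / 2) * z * (η x - z) * lapx (q0 η) x
      + (1 / 2) * z * (pdx1 η x * pdx1 (q0 η) x + pdx2 η x * pdx2 (q0 η) x) :=
    deriv_cubic_profile _ _ _ z
  rw [h1, h2, h3, lapx]
  ring
end

section
/- There exists a constant C > 0 such that the following holds. Let η : ℝ² → ℝ be smooth with η(x) > 0 for all x, and define q₀, w₁, w₂, w₃ as in the context. Then for every x ∈ ℝ² and every z with 0 ≤ z ≤ η(x), |w(x,z)| ≤ C·( |Δ_x η(x)| + |∇_x η(x)|/η(x) + |∇_x η(x)|²/η(x) ), where |w| denotes the Euclidean norm of (w₁,w₂,w₃). -/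
lemma hasDerivAt_neg_six_div_sq {f : ℝ → ℝ} {f' s : ℝ} (hf : HasDerivAt f f' s) (h0 : f s ≠ 0) :
    HasDerivAt (fun r => -6 / f r ^ 2) (12 * f' / f s ^ 3) s := by
  refine ((hasDerivAt_const s (-6 : ℝ)).fun_div (hf.fun_pow 2) (pow_ne_zero 2 h0)).congr_deriv ?_
  norm_num
  field_simp
  ring

lemma deriv_neg_six_div_sq {f : ℝ → ℝ} (hf : Differentiable ℝ f) (h0 : ∀ r, f r ≠ 0) :
    deriv (fun r => -6 / f r ^ 2) = fun s => 12 * deriv f s / f s ^ 3 :=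
  funext fun s => (hasDerivAt_neg_six_div_sq (hf s).hasDerivAt (h0 s)).deriv

lemma deriv_deriv_neg_six_div_sq {f : ℝ → ℝ} (hf : ContDiff ℝ 2 f) (h0 : ∀ r, f r ≠ 0) (s : ℝ) :
    deriv (deriv fun r => -6 / f r ^ 2) s =
      12 * deriv (deriv f) s / f s ^ 3 - 36 * deriv f s ^ 2 / f s ^ 4 := by
  have hd : Differentiable ℝ f := hf.differentiable (by norm_num)
  have hd' : Differentiable ℝ (deriv f) := hf.differentiable_deriv_two
  rw [deriv_neg_six_div_sq hd h0]
  have h := ((hd' s).hasDerivAt.const_mul 12).fun_div ((hd s).hasDerivAt.fun_pow 3)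
    (pow_ne_zero 3 (h0 s))
  rw [h.deriv]
  have hs := h0 s
  norm_num
  field_simp
  ring

section

variable {η : ℝ × ℝ → ℝ}

lemma pdx1_q0 (hη : ContDiff ℝ 2 η) (h0 : ∀ x, η x ≠ 0) (x : ℝ × ℝ) :
    pdx1 (q0 η) x = 12 * pdx1 η x / η x ^ 3 :=
  have hd : Differentiable ℝ fun s => η (s, x.2) :=
    (hη.comp (by fun_prop : ContDiff ℝ 2 fun s : ℝ => (s, x.2))).differentiable (by norm_num)
  congrFun (deriv_neg_six_div_sq hd fun _ => h0 _) x.1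

lemma pdx2_q0 (hη : ContDiff ℝ 2 η) (h0 : ∀ x, η x ≠ 0) (x : ℝ × ℝ) :
    pdx2 (q0 η) x = 12 * pdx2 η x / η x ^ 3 :=
  have hd : Differentiable ℝ fun s => η (x.1, s) :=
    (hη.comp (by fun_prop : ContDiff ℝ 2 fun s : ℝ => (x.1, s))).differentiable (by norm_num)
  congrFun (deriv_neg_six_div_sq hd fun _ => h0 _) x.2

lemma lapx_q0 (hη : ContDiff ℝ 2 η) (h0 : ∀ x, η x ≠ 0) (x : ℝ × ℝ) :
    lapx (q0 η) x =
      12 * lapx η x / η x ^ 3 - 36 * (pdx1 η x ^ 2 + pdx2 η x ^ 2) / η x ^ 4 := by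
  have h1 : pdx1 (pdx1 (q0 η)) x =
      12 * pdx1 (pdx1 η) x / η x ^ 3 - 36 * pdx1 η x ^ 2 / η x ^ 4 :=
    deriv_deriv_neg_six_div_sq
      (hη.comp (by fun_prop : ContDiff ℝ 2 fun s : ℝ => (s, x.2))) (fun _ => h0 _) x.1
  have h2 : pdx2 (pdx2 (q0 η)) x =
      12 * pdx2 (pdx2 η) x / η x ^ 3 - 36 * pdx2 η x ^ 2 / η x ^ 4 :=
    deriv_deriv_neg_six_div_sq
      (hη.comp (by fun_prop : ContDiff ℝ 2 fun s : ℝ => (x.1, s))) (fun _ => h0 _) x.2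
  simp only [lapx, h1, h2]
  ring

end

/-- Pointwise bound on the test function: there is a universal constant `C > 0` such that for
every smooth positive `η` and all `0 ≤ z ≤ η(x)`,
`|w(x,z)| ≤ C·(|Δ_xη| + |∇_xη|/η + |∇_xη|²/η)`. -/
theorem w_pointwise_bound : ∃ C : ℝ, 0 < C ∧
    ∀ (η : ℝ × ℝ → ℝ), ContDiff ℝ (⊤ : ℕ∞) η → (∀ x, 0 < η x) →
      ∀ (x : ℝ × ℝ) (z : ℝ), 0 ≤ z → z ≤ η x →
        Real.sqrt ((w1 η x z) ^ 2 + (w2 η x z) ^ 2 + (w3 η x z) ^ 2) ≤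
          C * (|lapx η x|
            + Real.sqrt ((pdx1 η x) ^ 2 + (pdx2 η x) ^ 2) / η x
            + (Real.sqrt ((pdx1 η x) ^ 2 + (pdx2 η x) ^ 2)) ^ 2 / η x) := by
  refine ⟨6, by norm_num, fun η hη hpos x z hz0 hz1 => ?_⟩
  have hη2 : ContDiff ℝ 2 η := mod_cast contDiff_infty.1 hη 2
  have h0 : ∀ x, η x ≠ 0 := fun x => (hpos x).ne'
  simp only [w1, w2, w3, pdx1_q0 hη2 h0, pdx2_q0 hη2 h0, lapx_q0 hη2 h0]
  have hh := hpos x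
  generalize η x = h at *
  generalize pdx1 η x = p
  generalize pdx2 η x = q
  generalize lapx η x = L
  set G := Real.sqrt (p ^ 2 + q ^ 2) with hG
  have hG0 : 0 ≤ G := Real.sqrt_nonneg _
  have hG2 : G ^ 2 = p ^ 2 + q ^ 2 := Real.sq_sqrt (by positivity)
  obtain ⟨t, rfl⟩ : ∃ t, z = t * h := ⟨z / h, by field_simp⟩
  have ht0 : 0 ≤ t := nonneg_of_mul_nonneg_left hz0 hh
  have ht1 : t ≤ 1 := by nlinarith
  have hk : |6 * t * (t - 1)| ≤ 6 := abs_le.2 ⟨by nlinarith, by nlinarith⟩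
  have hA : |t ^ 2 * (3 - 2 * t)| ≤ 6 :=
    abs_le.2 ⟨by nlinarith [sq_nonneg t], by nlinarith [sq_nonneg t, pow_le_one₀ ht0 ht1 (n := 2)]⟩
  have hB : |3 * t ^ 2 * (2 * t - 2)| ≤ 6 :=
    abs_le.2 ⟨by nlinarith [sq_nonneg t, pow_le_one₀ ht0 ht1 (n := 2)], by nlinarith [sq_nonneg t]⟩
  have hhor : (1 / 2 * (t * h) * (t * h - h) * (12 * p / h ^ 3)) ^ 2
      + (1 / 2 * (t * h) * (t * h - h) * (12 * q / h ^ 3)) ^ 2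
      = (|6 * t * (t - 1)| * (G / h)) ^ 2 := by
    rw [mul_pow |_|, sq_abs, div_pow, hG2]
    field_simp
    ring
  have hver : 1 / 12 * (t * h) ^ 2 * (3 * h - 2 * (t * h))
        * (12 * L / h ^ 3 - 36 * (p ^ 2 + q ^ 2) / h ^ 4)
      + 1 / 4 * (t * h) ^ 2 * (p * (12 * p / h ^ 3) + q * (12 * q / h ^ 3))
      = t ^ 2 * (3 - 2 * t) * L + 3 * t ^ 2 * (2 * t - 2) * (G ^ 2 / h) := by
    rw [hG2]
    field_simp
    ring
  rw [hhor, hver]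
  have hGh : 0 ≤ G / h := by positivity
  have hGGh : 0 ≤ G ^ 2 / h := by positivity
  have hver_le : |t ^ 2 * (3 - 2 * t) * L + 3 * t ^ 2 * (2 * t - 2) * (G ^ 2 / h)|
      ≤ 6 * |L| + 6 * (G ^ 2 / h) := by
    refine (abs_add_le _ _).trans ?_
    rw [abs_mul _ L, abs_mul _ (G ^ 2 / h), abs_of_nonneg hGGh]
    gcongr
  have hhor_le : |6 * t * (t - 1)| * (G / h) ≤ 6 * (G / h) := by gcongr
  refine Real.sqrt_le_iff.2 ⟨by positivity, ?_⟩
  have hhor_nonneg : 0 ≤ |6 * t * (t - 1)| * (G / h) := by positivity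
  rw [← sq_abs (t ^ 2 * (3 - 2 * t) * L + _)]
  refine (pow_add_pow_le hhor_nonneg (abs_nonneg _) two_ne_zero).trans (pow_le_pow_left₀ (by positivity) ?_ 2)
  linarith
end
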